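/- (Bistochastic maps) Let Φ be a unital positive trace-preserving map on Hermitian 2×2 matrices, i.e., in the Bloch-vector picture Φ: (x₀, x⃗) ↦ (x₀, Λx⃗) with t⃗ = 0 and Λ = diag(λ₁,λ₂,λ₃) where |λ_i| ≤ 1. Set w = max(λ₁², λ₂², λ₃²). Then for every qubit state ρ with vector x, the concurrence is C_Φ(ρ) = √((1−w)x₀² + Σ_{i=1}^{3}(w − λ_i²)x_i²), and the matrix Q_w = diag(1−w, w−λ₁², w−λ₂², w−λ₃²) is positive semidefinite with a nonzero kernel vector n having n₀ = 0. -/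

import Mathlib

open scoped Matrix ComplexOrder
open Matrix

noncomputable section

/-- Pauli matrix σ₁ -/
def pauli1 : Matrix (Fin 2) (Fin 2) ℂ := !![0, 1; 1, 0]
/-- Pauli matrix σ₂ -/
def pauli2 : Matrix (Fin 2) (Fin 2) ℂ := !![0, -Complex.I; Complex.I, 0]
/-- Pauli matrix σ₃ -/
def pauli3 : Matrix (Fin 2) (Fin 2) ℂ := !![1, 0; 0, -1]

/-- The map x ↦ ½(x₀ I + x₁σ₁ + x₂σ₂ + x₃σ₃). -/
def toMat (x : Fin 4 → ℝ) : Matrix (Fin 2) (Fin 2) ℂ :=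
  (1 / 2 : ℂ) • ((x 0 : ℂ) • (1 : Matrix (Fin 2) (Fin 2) ℂ) +
    (x 1 : ℂ) • pauli1 + (x 2 : ℂ) • pauli2 + (x 3 : ℂ) • pauli3)

/-- Minkowski inner product on ℝ⁴. -/
def mink (x y : Fin 4 → ℝ) : ℝ := x 0 * y 0 - x 1 * y 1 - x 2 * y 2 - x 3 * y 3

/-- Bloch-picture action of a trace-preserving linear map:
(x₀, x⃗) ↦ (x₀, x₀ t⃗ + Λ x⃗). -/
def phiVec (t : Fin 3 → ℝ) (Λ : Matrix (Fin 3) (Fin 3) ℝ) (x : Fin 4 → ℝ) : Fin 4 → ℝ :=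
  ![x 0,
    x 0 * t 0 + ∑ j : Fin 3, Λ 0 j * x j.succ,
    x 0 * t 1 + ∑ j : Fin 3, Λ 1 j * x j.succ,
    x 0 * t 2 + ∑ j : Fin 3, Λ 2 j * x j.succ]

/-- The quadratic form q_w(x) = Φ(x)·Φ(x) − w x·x. -/
def qform (t : Fin 3 → ℝ) (Λ : Matrix (Fin 3) (Fin 3) ℝ) (w : ℝ) (x : Fin 4 → ℝ) : ℝ :=
  mink (phiVec t Λ x) (phiVec t Λ x) - w * mink x x

/-- Positivity of the map in the Bloch picture: positive semidefinite matrices are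
mapped to positive semidefinite matrices. -/
def IsPosMap (t : Fin 3 → ℝ) (Λ : Matrix (Fin 3) (Fin 3) ℝ) : Prop :=
  ∀ x : Fin 4 → ℝ, (toMat x).PosSemidef → (toMat (phiVec t Λ x)).PosSemidef

/-- x is the Bloch vector of a qubit state. -/
def IsStateVec (x : Fin 4 → ℝ) : Prop := (toMat x).PosSemidef ∧ x 0 = 1

/-- x is the Bloch vector of a pure qubit state (determinant zero, i.e. x·x = 0). -/
def IsPureVec (x : Fin 4 → ℝ) : Prop := (toMat x).PosSemidef ∧ x 0 = 1 ∧ mink x x = 0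

/-- Concurrence of a pure state: C_Φ(π) = 2√(det Φ(π)). -/
def pureConc (t : Fin 3 → ℝ) (Λ : Matrix (Fin 3) (Fin 3) ℝ) (y : Fin 4 → ℝ) : ℝ :=
  2 * Real.sqrt ((toMat (phiVec t Λ y)).det.re)

/-- Concurrence of a (mixed) state with Bloch vector x: the infimum over finite
convex decompositions into pure states of the average pure-state concurrence. -/
def conc (t : Fin 3 → ℝ) (Λ : Matrix (Fin 3) (Fin 3) ℝ) (x : Fin 4 → ℝ) : ℝ :=
  sInf {c : ℝ | ∃ (k : ℕ) (p : Fin k → ℝ) (y : Fin k → (Fin 4 → ℝ)),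
    (∀ j, 0 < p j) ∧ (∑ j, p j) = 1 ∧ (∀ j, IsPureVec (y j)) ∧
    (∀ i, (∑ j, p j * y j i) = x i) ∧ c = ∑ j, p j * pureConc t Λ (y j)}

end

lemma toMat_det (x : Fin 4 → ℝ) : (toMat x).det = ((mink x x / 4 : ℝ) : ℂ) := by
  simp only [toMat, pauli1, pauli2, pauli3, mink, Matrix.det_fin_two]
  simp
  linear_combination (1 / 4 * (x 2 : ℂ) ^ 2) * Complex.I_sq

lemma toMat_isHermitian (x : Fin 4 → ℝ) : (toMat x).IsHermitian := by
  ext i j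
  fin_cases i <;> fin_cases j <;> simp [toMat, pauli1, pauli2, pauli3, mul_add]

lemma mink_nonneg_of_posSemidef {x : Fin 4 → ℝ} (h : (toMat x).PosSemidef) : 0 ≤ mink x x := by
  have h1 := h.det_nonneg
  rw [toMat_det] at h1
  have h2 : 0 ≤ mink x x / 4 := by exact_mod_cast h1
  linarith

/-- A trace-one vector on the light cone corresponds to a projection, hence to a pure state. -/
lemma isPureVec_of_mink_eq_zero {x : Fin 4 → ℝ} (h0 : x 0 = 1) (h : mink x x = 0) :
    IsPureVec x := by
  refine ⟨?_, h0, h⟩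
  have hsq : toMat x * toMat x = toMat x := by
    have hc : (1 : ℂ) = (x 1 : ℂ) ^ 2 + (x 2 : ℂ) ^ 2 + (x 3 : ℂ) ^ 2 := by
      simp only [mink, h0] at h
      exact_mod_cast (by linarith : (1 : ℝ) = x 1 ^ 2 + x 2 ^ 2 + x 3 ^ 2)
    ext i j
    fin_cases i <;> fin_cases j <;>
      simp [toMat, pauli1, pauli2, pauli3, Matrix.mul_apply, Fin.sum_univ_two, h0]
    · linear_combination (-1 / 4 : ℂ) * hc - (1 / 4 * (x 2 : ℂ) ^ 2) * Complex.I_sq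
    · ring
    · ring
    · linear_combination (-1 / 4 : ℂ) * hc - (1 / 4 * (x 2 : ℂ) ^ 2) * Complex.I_sq
  have := Matrix.posSemidef_conjTranspose_mul_self (toMat x)
  rwa [(toMat_isHermitian x).eq, hsq] at this

lemma qform_diagonal (lam : Fin 3 → ℝ) (w : ℝ) (x : Fin 4 → ℝ) :
    qform 0 (Matrix.diagonal lam) w x =
      ∑ a, ![1 - w, w - lam 0 ^ 2, w - lam 1 ^ 2, w - lam 2 ^ 2] a * x a ^ 2 := by
  simp [qform, phiVec, mink, Fin.sum_univ_four, Matrix.diagonal_apply]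
  ring

lemma pureConc_eq_sqrt_qform (t : Fin 3 → ℝ) (Λ : Matrix (Fin 3) (Fin 3) ℝ) (w : ℝ)
    {y : Fin 4 → ℝ} (hy : mink y y = 0) : pureConc t Λ y = √(qform t Λ w y) := by
  rw [pureConc, toMat_det, Complex.ofReal_re, Real.sqrt_div' _ (by norm_num),
    show (4 : ℝ) = 2 ^ 2 by norm_num, Real.sqrt_sq (by norm_num), qform, hy]
  simp
  ring

/-- The square root of a nonnegative diagonal quadratic form is convex. -/
lemma sqrt_diagonal_form_le {ι κ : Type*} [Fintype ι] [Fintype κ] {c : ι → ℝ}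
    (hc : ∀ a, 0 ≤ c a) {p : κ → ℝ} (hp : ∀ j, 0 ≤ p j) (y : κ → ι → ℝ) :
    √(∑ a, c a * (∑ j, p j * y j a) ^ 2) ≤ ∑ j, p j * √(∑ a, c a * y j a ^ 2) := by
  let v (z : ι → ℝ) : EuclideanSpace ℝ ι := WithLp.toLp 2 fun a => √(c a) * z a
  have hv (z : ι → ℝ) : √(∑ a, c a * z a ^ 2) = ‖v z‖ := by
    simp [v, EuclideanSpace.norm_eq, mul_pow, Real.sq_sqrt (hc _)]
  have hsum : v (fun a => ∑ j, p j * y j a) = ∑ j, p j • v (y j) := by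
    ext a
    simp only [v, WithLp.ofLp_sum, Finset.sum_apply, WithLp.ofLp_smul, Pi.smul_apply, smul_eq_mul,
      Finset.mul_sum]
    exact Finset.sum_congr rfl fun j _ => by ring
  simp only [hv]
  rw [hsum]
  refine (norm_sum_le _ _).trans_eq (Finset.sum_congr rfl fun j _ => ?_)
  rw [norm_smul, Real.norm_of_nonneg (hp j)]

lemma mink_self_update (x : Fin 4 → ℝ) (i : Fin 3) (s : ℝ) :
    mink (Function.update x i.succ s) (Function.update x i.succ s) =
      mink x x + x i.succ ^ 2 - s ^ 2 := by
  fin_cases i <;> simp [mink, Function.update] <;> ring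

/-- Every state is a mixture of pure states differing from it only in one chosen spatial
coordinate. -/
lemma exists_pure_decomposition_along {x : Fin 4 → ℝ} (hx : IsStateVec x) (i : Fin 3) :
    ∃ (k : ℕ) (p : Fin k → ℝ) (y : Fin k → (Fin 4 → ℝ)),
      (∀ j, 0 < p j) ∧ (∑ j, p j) = 1 ∧ (∀ j, IsPureVec (y j)) ∧
      (∀ a, (∑ j, p j * y j a) = x a) ∧ ∀ j a, a ≠ i.succ → y j a = x a := by
  obtain ⟨hpos, h0⟩ := hx
  rcases (mink_nonneg_of_posSemidef hpos).eq_or_lt with hm | hm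
  · exact ⟨1, fun _ => 1, fun _ => x, by simp, by simp,
      fun _ => isPureVec_of_mink_eq_zero h0 hm.symm, by simp, by simp⟩
  set u := x i.succ with hu
  set r := √(mink x x + u ^ 2) with hr
  have hr2 : r ^ 2 = mink x x + u ^ 2 := Real.sq_sqrt (by positivity)
  have hr0 : 0 < r := Real.sqrt_pos.2 (by positivity)
  obtain ⟨hl, hg⟩ := abs_lt.1 (abs_lt_of_sq_lt_sq (by linarith : u ^ 2 < r ^ 2) hr0.le)
  have hpure (s : ℝ) (hs : s ^ 2 = r ^ 2) : IsPureVec (Function.update x i.succ s) := by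
    refine isPureVec_of_mink_eq_zero ?_ ?_
    · rw [Function.update_of_ne (Fin.succ_ne_zero i).symm, h0]
    · rw [mink_self_update, hs, hr2]
      ring
  refine ⟨2, ![(r + u) / (2 * r), (r - u) / (2 * r)],
    ![Function.update x i.succ r, Function.update x i.succ (-r)], ?_, ?_, ?_, ?_, ?_⟩
  · rw [Fin.forall_fin_two]
    exact ⟨div_pos (by linarith) (by linarith), div_pos (by linarith) (by linarith)⟩
  · simp
    field_simp
    ring
  · rw [Fin.forall_fin_two]
    exact ⟨hpure r rfl, hpure (-r) (neg_sq r)⟩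
  · intro a
    by_cases ha : a = i.succ
    · subst ha
      simp
      field_simp
      ring
    · simp [Function.update_of_ne ha]
      field_simp
      ring
  · rw [Fin.forall_fin_two]
    exact ⟨fun a ha => Function.update_of_ne ha _ _, fun a ha => Function.update_of_ne ha _ _⟩

lemma conc_diagonal {lam : Fin 3 → ℝ} {w : ℝ} (hw1 : w ≤ 1) (hlw : ∀ i, lam i ^ 2 ≤ w)
    {i : Fin 3} (hi : w = lam i ^ 2) {x : Fin 4 → ℝ} (hx : IsStateVec x) :
    conc 0 (Matrix.diagonal lam) x = √(qform 0 (Matrix.diagonal lam) w x) := by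
  refine IsLeast.csInf_eq ⟨?_, ?_⟩
  · obtain ⟨k, p, y, hp, hp1, hy, hxy, hyx⟩ := exists_pure_decomposition_along hx i
    refine ⟨k, p, y, hp, hp1, hy, hxy, ?_⟩
    have hq (j) : qform 0 (Matrix.diagonal lam) w (y j) = qform 0 (Matrix.diagonal lam) w x := by
      simp only [qform_diagonal]
      refine Finset.sum_congr rfl fun a _ => ?_
      by_cases ha : a = i.succ
      · have : ![1 - w, w - lam 0 ^ 2, w - lam 1 ^ 2, w - lam 2 ^ 2] a = 0 := by
          subst ha
          fin_cases i <;> simpa [sub_eq_zero] using hi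
        simp [this]
      · rw [hyx j a ha]
    simp [pureConc_eq_sqrt_qform _ _ w (hy _).2.2, hq, ← Finset.sum_mul, hp1]
  · rintro c ⟨k, p, y, hp, -, hy, hxy, rfl⟩
    simp only [pureConc_eq_sqrt_qform _ _ w (hy _).2.2, qform_diagonal, ← hxy]
    refine sqrt_diagonal_form_le (fun a => ?_) (fun j => (hp j).le) y
    fin_cases a <;> simp [hw1, hlw]

/-- bistochastic maps: for a unital channel with t⃗ = 0 and
Λ = diag(λ₁,λ₂,λ₃), |λᵢ| ≤ 1, with w = max λᵢ², the matrix
Q_w = diag(1−w, w−λ₁², w−λ₂², w−λ₃²) represents q_w, is positive semidefinite, has a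
nonzero kernel vector n with n₀ = 0, and the concurrence of every qubit state is
C_Φ(ρ) = √((1−w)x₀² + Σᵢ(w−λᵢ²)xᵢ²). -/
theorem stmt14 (lam : Fin 3 → ℝ) (hlam : ∀ i, |lam i| ≤ 1)
    (w : ℝ) (hw : w = max (lam 0 ^ 2) (max (lam 1 ^ 2) (lam 2 ^ 2)))
    (Qw : Matrix (Fin 4) (Fin 4) ℝ)
    (hQw : Qw = Matrix.diagonal ![1 - w, w - lam 0 ^ 2, w - lam 1 ^ 2, w - lam 2 ^ 2]) :
    (∀ x : Fin 4 → ℝ, x ⬝ᵥ Qw.mulVec x = qform 0 (Matrix.diagonal lam) w x) ∧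
    Qw.PosSemidef ∧
    (∃ n : Fin 4 → ℝ, n ≠ 0 ∧ n 0 = 0 ∧ Qw.mulVec n = 0) ∧
    (∀ x : Fin 4 → ℝ, IsStateVec x →
      conc 0 (Matrix.diagonal lam) x =
        Real.sqrt ((1 - w) * x 0 ^ 2 +
          ((w - lam 0 ^ 2) * x 1 ^ 2 + (w - lam 1 ^ 2) * x 2 ^ 2 +
            (w - lam 2 ^ 2) * x 3 ^ 2))) := by
  have hlw : ∀ i, lam i ^ 2 ≤ w := by
    intro i
    fin_cases i <;> simp [hw]
  obtain ⟨i, hi⟩ : ∃ i, w = lam i ^ 2 := by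
    rcases max_choice (lam 0 ^ 2) (max (lam 1 ^ 2) (lam 2 ^ 2)) with h | h
    · exact ⟨0, hw.trans h⟩
    · rcases max_choice (lam 1 ^ 2) (lam 2 ^ 2) with h' | h'
      · exact ⟨1, hw.trans (h.trans h')⟩
      · exact ⟨2, hw.trans (h.trans h')⟩
  have hw1 : w ≤ 1 := hi ▸ (sq_le_one_iff_abs_le_one _).2 (hlam i)
  subst hQw
  refine ⟨fun x => ?_, ?_, ⟨Pi.single i.succ 1, by simp, by simp, ?_⟩, fun x hx => ?_⟩
  · rw [qform_diagonal]
    simp only [dotProduct, Matrix.mulVec_diagonal]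
    exact Finset.sum_congr rfl fun a _ => by ring
  · refine Matrix.PosSemidef.diagonal fun a => ?_
    fin_cases a <;> simp [hw1, hlw]
  · ext a
    rw [Matrix.mulVec_diagonal]
    fin_cases i <;> fin_cases a <;> simp <;> simpa [sub_eq_zero] using hi
  · rw [conc_diagonal hw1 hlw hi hx, qform_diagonal]
    congr 1
    simp [Fin.sum_univ_four]
    ring
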